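/- arXiv:2605.12815 — 2 statements merged into one kernel-verified Lean document; each statement's English description precedes it below -/
import Mathlib

section
/- For every ρ > 0, the two-sided bound π/(3(ρ²+1)) ≤ I(ρ) ≤ π/(3ρ²) holds. -/
open Real Filter MeasureTheory

/-- The arclength-rescaled Möbius energy density integrand of the helix of pitch `ρ`. -/
noncomputable def helixM (ρ t : ℝ) : ℝ :=
  (ρ ^ 2 + 1) / (ρ ^ 2 * t ^ 2 + 4 * Real.sin (t / 2) ^ 2) - 1 / t ^ 2

/-- The arclength-rescaled Möbius energy density of the helix of pitch `ρ`. -/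
noncomputable def helixI (ρ : ℝ) : ℝ := ∫ t : ℝ, helixM ρ t

lemma sq_sub_two_add_two_mul_cos_nonneg (t : ℝ) : 0 ≤ t ^ 2 - 2 + 2 * cos t := by
  linarith [one_sub_sq_div_two_le_cos (x := t)]

lemma four_mul_sin_half_sq (t : ℝ) : 4 * sin (t / 2) ^ 2 = 2 - 2 * cos t := by
  have h := cos_sq_add_sin_sq (t / 2)
  have h' := cos_two_mul (t / 2)
  rw [mul_div_cancel₀ t two_ne_zero] at h'
  linarith

/-- An antiderivative of `t ↦ (t ^ 2 - 2 + 2 * cos t) * exp (-(x * t))`. -/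
noncomputable def laplacePrimitive (x t : ℝ) : ℝ :=
  (2 / x - 2 * (x * cos t - sin t) / (1 + x ^ 2)
    - ((x * t) ^ 2 + 2 * (x * t) + 2) / x ^ 3) * exp (-(x * t))

lemma hasDerivAt_laplacePrimitive {x : ℝ} (hx : 0 < x) (t : ℝ) :
    HasDerivAt (laplacePrimitive x) ((t ^ 2 - 2 + 2 * cos t) * exp (-(x * t))) t := by
  have hlin : HasDerivAt (fun t : ℝ => x * t) x t := by
    simpa using (hasDerivAt_id t).const_mul x
  have hosc := ((((hasDerivAt_cos t).const_mul x).sub (hasDerivAt_sin t)).const_mul 2).div_const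
    (1 + x ^ 2)
  have hpoly := (((hlin.pow 2).add (hlin.const_mul 2)).add_const 2).div_const (x ^ 3)
  have h := ((hosc.const_sub (2 / x)).sub hpoly).mul hlin.neg.exp
  refine h.congr_deriv ?_
  have hx' : 1 + x ^ 2 ≠ 0 := by positivity
  simp only [Pi.sub_apply, Pi.add_apply, Pi.pow_apply, Pi.neg_apply]
  field_simp
  ring

lemma tendsto_laplacePrimitive_atTop {x : ℝ} (hx : 0 < x) :
    Tendsto (laplacePrimitive x) atTop (nhds 0) := by
  have hpow (n : ℕ) : Tendsto (fun t : ℝ => (x * t) ^ n * exp (-(x * t))) atTop (nhds 0) :=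
    (tendsto_pow_mul_exp_neg_atTop_nhds_zero n).comp (tendsto_id.const_mul_atTop hx)
  have hosc : Tendsto (fun t : ℝ =>
      (2 / x - 2 * (x * cos t - sin t) / (1 + x ^ 2)) * exp (-(x * t))) atTop (nhds 0) := by
    refine squeeze_zero_norm (a := fun t => (2 / x + 2 * (x + 1) / (1 + x ^ 2)) *
      ((x * t) ^ 0 * exp (-(x * t)))) (fun t => ?_) (by simpa using (hpow 0).const_mul _)
    rw [norm_mul, norm_of_nonneg (exp_pos _).le, pow_zero, one_mul]
    gcongr
    have h₁ : |x * cos t - sin t| ≤ x + 1 := by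
      rw [abs_le]
      constructor <;> nlinarith [neg_one_le_cos t, cos_le_one t, neg_one_le_sin t, sin_le_one t]
    calc ‖2 / x - 2 * (x * cos t - sin t) / (1 + x ^ 2)‖
        ≤ ‖2 / x‖ + ‖2 * (x * cos t - sin t) / (1 + x ^ 2)‖ := norm_sub_le _ _
      _ = 2 / x + 2 * |x * cos t - sin t| / (1 + x ^ 2) := by
        rw [norm_of_nonneg (by positivity : 0 ≤ 2 / x), norm_div, norm_mul,
          norm_of_nonneg (by positivity : 0 ≤ 1 + x ^ 2)]
        simp
      _ ≤ _ := by gcongr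
  have hpoly := (((hpow 2).add ((hpow 1).const_mul 2)).add ((hpow 0).const_mul 2)).div_const (x ^ 3)
  have h := hosc.sub hpoly
  simp only [mul_zero, add_zero, zero_div, sub_zero] at h
  refine h.congr fun t => ?_
  simp only [laplacePrimitive]
  ring

lemma integrableOn_laplace {x : ℝ} (hx : 0 < x) :
    IntegrableOn (fun t : ℝ => (t ^ 2 - 2 + 2 * cos t) * exp (-(x * t))) (Set.Ioi 0) :=
  integrableOn_Ioi_deriv_of_nonneg' (fun t _ => hasDerivAt_laplacePrimitive hx t)
    (fun t _ => mul_nonneg (sq_sub_two_add_two_mul_cos_nonneg t) (exp_pos _).le)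
    (tendsto_laplacePrimitive_atTop hx)

lemma integral_laplace {x : ℝ} (hx : 0 < x) :
    ∫ t in Set.Ioi (0 : ℝ), (t ^ 2 - 2 + 2 * cos t) * exp (-(x * t))
      = 2 / (x ^ 3 * (1 + x ^ 2)) := by
  rw [integral_Ioi_of_hasDerivAt_of_nonneg' (fun t _ => hasDerivAt_laplacePrimitive hx t)
    (fun t _ => mul_nonneg (sq_sub_two_add_two_mul_cos_nonneg t) (exp_pos _).le)
    (tendsto_laplacePrimitive_atTop hx)]
  have hx' : 1 + x ^ 2 ≠ 0 := by positivity
  simp only [laplacePrimitive, mul_zero, cos_zero, sin_zero, neg_zero, exp_zero]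
  field_simp
  ring

lemma integral_cube_mul_exp_neg_mul_Ioi {t : ℝ} (ht : 0 < t) :
    ∫ x in Set.Ioi (0 : ℝ), x ^ 3 * exp (-(x * t)) = 6 / t ^ 4 := by
  have h := integral_rpow_mul_exp_neg_mul_Ioi (a := 4) (by norm_num) ht
  have hG : Gamma 4 = 6 := by
    rw [show (4 : ℝ) = (3 : ℕ) + 1 by norm_num, Gamma_nat_eq_factorial]
    norm_num [Nat.factorial]
  have h4 : (1 / t) ^ (4 : ℝ) = (1 / t) ^ 4 := by exact_mod_cast rpow_natCast (1 / t) 4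
  rw [hG, h4] at h
  calc ∫ x in Set.Ioi (0 : ℝ), x ^ 3 * exp (-(x * t))
      = ∫ x in Set.Ioi (0 : ℝ), x ^ ((4 : ℝ) - 1) * exp (-(t * x)) := by
        refine integral_congr_ae (ae_of_all _ fun x => ?_)
        have h3 : x ^ ((4 : ℝ) - 1) = x ^ 3 := by
          rw [show (4 : ℝ) - 1 = (3 : ℕ) by norm_num, rpow_natCast]
        simp only [h3, mul_comm x t]
    _ = 6 / t ^ 4 := by rw [h]; field_simp

lemma integral_Ioi_sq_sub_two_add_two_mul_cos_div :
    ∫ t in Set.Ioi (0 : ℝ), (t ^ 2 - 2 + 2 * cos t) / t ^ 4 = π / 6 := by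
  let F : ℝ → ℝ → ℝ := fun t x => x ^ 3 / 6 * ((t ^ 2 - 2 + 2 * cos t) * exp (-(x * t)))
  have hFt {x : ℝ} (hx : 0 < x) : ∫ t in Set.Ioi (0 : ℝ), F t x = 1 / 3 * (1 + x ^ 2)⁻¹ := by
    have hx' : 1 + x ^ 2 ≠ 0 := by positivity
    simp only [F]
    rw [integral_const_mul, integral_laplace hx]
    field_simp
    norm_num
  have hFx {t : ℝ} (ht : 0 < t) :
      ∫ x in Set.Ioi (0 : ℝ), F t x = (t ^ 2 - 2 + 2 * cos t) / t ^ 4 := by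
    have hF : F t = fun x => (t ^ 2 - 2 + 2 * cos t) / 6 * (x ^ 3 * exp (-(x * t))) := by
      ext x
      simp only [F]
      ring
    rw [hF, integral_const_mul, integral_cube_mul_exp_neg_mul_Ioi ht]
    field_simp
  have hint : Integrable (Function.uncurry F)
      ((volume.restrict (Set.Ioi 0)).prod (volume.restrict (Set.Ioi 0))) := by
    rw [integrable_prod_iff' (by
      apply Continuous.aestronglyMeasurable
      simp only [F, Function.uncurry_def]
      fun_prop)]
    constructor
    · refine (ae_restrict_iff' measurableSet_Ioi).2 (ae_of_all _ fun x hx => ?_)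
      exact (integrableOn_laplace hx).const_mul (x ^ 3 / 6)
    · refine (integrable_inv_one_add_sq.integrableOn.const_mul (1 / 3)).congr ?_
      refine (ae_restrict_iff' measurableSet_Ioi).2 (ae_of_all _ fun x (hx : 0 < x) => ?_)
      simp only [Function.uncurry_apply_pair]
      rw [← hFt hx]
      refine integral_congr_ae (ae_of_all _ fun t => (norm_of_nonneg ?_).symm)
      have := sq_sub_two_add_two_mul_cos_nonneg t
      positivity
  calc ∫ t in Set.Ioi (0 : ℝ), (t ^ 2 - 2 + 2 * cos t) / t ^ 4
      = ∫ t in Set.Ioi (0 : ℝ), ∫ x in Set.Ioi (0 : ℝ), F t x :=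
        setIntegral_congr_fun measurableSet_Ioi fun t ht => (hFx ht).symm
    _ = ∫ x in Set.Ioi (0 : ℝ), ∫ t in Set.Ioi (0 : ℝ), F t x := integral_integral_swap hint
    _ = ∫ x in Set.Ioi (0 : ℝ), 1 / 3 * (1 + x ^ 2)⁻¹ :=
        setIntegral_congr_fun measurableSet_Ioi fun x hx => hFt hx
    _ = π / 6 := by
        rw [integral_const_mul, integral_Ioi_inv_one_add_sq, arctan_zero]
        ring

lemma integral_sq_sub_two_add_two_mul_cos_div :
    ∫ t : ℝ, (t ^ 2 - 2 + 2 * cos t) / t ^ 4 = π / 3 := by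
  have h := integral_comp_abs (f := fun t => (t ^ 2 - 2 + 2 * cos t) / t ^ 4)
  simp only [sq_abs, cos_abs, (show Even 4 by decide).pow_abs,
    integral_Ioi_sq_sub_two_add_two_mul_cos_div] at h
  rw [h]
  ring

lemma integrable_sq_sub_two_add_two_mul_cos_div :
    Integrable fun t : ℝ => (t ^ 2 - 2 + 2 * cos t) / t ^ 4 :=
  .of_integral_ne_zero (by rw [integral_sq_sub_two_add_two_mul_cos_div]; positivity)

lemma helixM_eq {ρ t : ℝ} (hρ : 0 < ρ) (ht : t ≠ 0) :
    helixM ρ t = (t ^ 2 - 2 + 2 * cos t) / (t ^ 2 * (ρ ^ 2 * t ^ 2 + (2 - 2 * cos t))) := by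
  have hden : ρ ^ 2 * t ^ 2 + (2 - 2 * cos t) ≠ 0 := by
    have := cos_le_one t
    have : 0 < ρ ^ 2 * t ^ 2 := by positivity
    linarith
  rw [helixM, four_mul_sin_half_sq, div_sub_div _ _ hden (pow_ne_zero 2 ht)]
  congr 1 <;> ring

lemma le_helixM {ρ : ℝ} (hρ : 0 < ρ) (t : ℝ) :
    1 / (ρ ^ 2 + 1) * ((t ^ 2 - 2 + 2 * cos t) / t ^ 4) ≤ helixM ρ t := by
  rcases eq_or_ne t 0 with rfl | ht
  · simp [helixM]
  have hnum := sq_sub_two_add_two_mul_cos_nonneg t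
  have hcos := cos_le_one t
  have hpos : 0 < ρ ^ 2 * t ^ 2 := by positivity
  rw [helixM_eq hρ ht, div_mul_div_comm, one_mul]
  refine div_le_div_of_nonneg_left hnum (mul_pos (by positivity) (by linarith)) ?_
  calc t ^ 2 * (ρ ^ 2 * t ^ 2 + (2 - 2 * cos t)) ≤ t ^ 2 * (ρ ^ 2 * t ^ 2 + t ^ 2) := by
        gcongr
        linarith
    _ = (ρ ^ 2 + 1) * t ^ 4 := by ring

lemma helixM_le {ρ : ℝ} (hρ : 0 < ρ) (t : ℝ) :
    helixM ρ t ≤ 1 / ρ ^ 2 * ((t ^ 2 - 2 + 2 * cos t) / t ^ 4) := by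
  rcases eq_or_ne t 0 with rfl | ht
  · simp [helixM]
  have hcos := cos_le_one t
  rw [helixM_eq hρ ht, div_mul_div_comm, one_mul]
  refine div_le_div_of_nonneg_left (sq_sub_two_add_two_mul_cos_nonneg t) (by positivity) ?_
  calc ρ ^ 2 * t ^ 4 = t ^ 2 * (ρ ^ 2 * t ^ 2 + 0) := by ring
    _ ≤ t ^ 2 * (ρ ^ 2 * t ^ 2 + (2 - 2 * cos t)) := by
        gcongr
        linarith

lemma integrable_helixM {ρ : ℝ} (hρ : 0 < ρ) : Integrable (helixM ρ) := by
  refine (integrable_sq_sub_two_add_two_mul_cos_div.const_mul (1 / ρ ^ 2)).mono' ?_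
    (ae_of_all _ fun t => ?_)
  · apply Measurable.aestronglyMeasurable
    unfold helixM
    fun_prop
  · have hnum := sq_sub_two_add_two_mul_cos_nonneg t
    rw [norm_of_nonneg (le_trans (by positivity) (le_helixM hρ t))]
    exact helixM_le hρ t

theorem helixI_two_sided_bound (ρ : ℝ) (hρ : 0 < ρ) :
    π / (3 * (ρ ^ 2 + 1)) ≤ helixI ρ ∧ helixI ρ ≤ π / (3 * ρ ^ 2) := by
  have hg := integrable_sq_sub_two_add_two_mul_cos_div
  have hlow := integral_mono (hg.const_mul _) (integrable_helixM hρ) (le_helixM hρ)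
  have hupp := integral_mono (integrable_helixM hρ) (hg.const_mul _) (helixM_le hρ)
  rw [integral_const_mul, integral_sq_sub_two_add_two_mul_cos_div, div_mul_div_comm, one_mul,
    mul_comm _ (3 : ℝ)] at hlow hupp
  exact ⟨hlow, hupp⟩
end

section
/- Define, for ρ > 0 and integers k ≥ 1, the complex numbers D_k(ρ) = ρ·arcsinh(kπρ)/(kπ) + √((kπρ)² + 1) − iρ, and set F(ρ) = Σ_{k=1}^∞ Re(1/(k·D_k(ρ))). Then F(ρ) is asymptotically equivalent to G(ρ) as ρ → 0⁺; that is, lim_{ρ→0⁺} F(ρ)/G(ρ) = 1. -/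
open Real Complex Filter

/-- The auxiliary series `G(ρ) = Σ_{k≥1} 1/(k√((kπρ)² + 1))`. -/
noncomputable def helixG (ρ : ℝ) : ℝ :=
  ∑' k : ℕ, 1 / (((k : ℝ) + 1) * Real.sqrt ((((k : ℝ) + 1) * π * ρ) ^ 2 + 1))

/-- The complex perturbation `D_k(ρ) = ρ·arcsinh(kπρ)/(kπ) + √((kπρ)² + 1) - iρ`. -/
noncomputable def helixD (ρ : ℝ) (k : ℕ) : ℂ :=
  ((ρ * Real.arsinh ((k : ℝ) * π * ρ) / ((k : ℝ) * π) +
    Real.sqrt (((k : ℝ) * π * ρ) ^ 2 + 1) : ℝ) : ℂ) - Complex.I * (ρ : ℂ)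

/-- The perturbed series `F(ρ) = Σ_{k≥1} Re (1/(k·D_k(ρ)))`. -/
noncomputable def helixF (ρ : ℝ) : ℝ :=
  ∑' k : ℕ, (1 / ((((k : ℝ) + 1) : ℂ) * helixD ρ (k + 1))).re

lemma arsinh_le_self {x : ℝ} (hx : 0 ≤ x) : Real.arsinh x ≤ x := by
  rw [← Real.sinh_le_sinh, Real.sinh_arsinh]
  exact Real.self_le_sinh_iff.2 hx

lemma re_one_div_mul_sub_I_mul (c A ρ : ℝ) :
    (1 / ((c : ℂ) * ((A : ℂ) - Complex.I * (ρ : ℂ)))).re = 1 / c * (A / (A ^ 2 + ρ ^ 2)) := by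
  rw [← one_div_mul_one_div, ← Complex.ofReal_one, ← Complex.ofReal_div, Complex.re_ofReal_mul,
    Complex.ofReal_one, one_div ((A : ℂ) - _), Complex.inv_re, Complex.normSq_apply]
  simp [pow_two]

lemma helixG_term_pos (ρ : ℝ) (k : ℕ) :
    0 < 1 / (((k : ℝ) + 1) * Real.sqrt ((((k : ℝ) + 1) * π * ρ) ^ 2 + 1)) := by
  positivity

lemma summable_helixG {ρ : ℝ} (hρ : 0 < ρ) :
    Summable fun k : ℕ => 1 / (((k : ℝ) + 1) * Real.sqrt ((((k : ℝ) + 1) * π * ρ) ^ 2 + 1)) := by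
  have hs : Summable fun k : ℕ => 1 / (π * ρ) * (1 / ((k : ℝ) + 1) ^ 2) := by
    have h := (summable_nat_add_iff 1).2 (Real.summable_one_div_nat_pow.2 one_lt_two)
    simpa using h.mul_left (1 / (π * ρ))
  refine hs.of_nonneg_of_le (fun k => (helixG_term_pos ρ k).le) fun k => ?_
  have hle : ((k : ℝ) + 1) * π * ρ ≤ Real.sqrt ((((k : ℝ) + 1) * π * ρ) ^ 2 + 1) :=
    Real.le_sqrt_of_sq_le (by linarith)
  rw [one_div_mul_one_div]
  refine one_div_le_one_div_of_le (by positivity) ?_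
  calc π * ρ * ((k : ℝ) + 1) ^ 2 = ((k : ℝ) + 1) * (((k : ℝ) + 1) * π * ρ) := by ring
    _ ≤ _ := by gcongr

lemma helixG_pos {ρ : ℝ} (hρ : 0 < ρ) : 0 < helixG ρ :=
  (summable_helixG hρ).tsum_pos (fun k => (helixG_term_pos ρ k).le) 0 (helixG_term_pos ρ 0)

/-- Each term of `helixF` is squeezed between the term of `helixG` and that term divided by
`1 + 2ρ²`. -/
lemma helixF_term_bounds {ρ : ℝ} (hρ : 0 < ρ) (k : ℕ) :
    (1 + 2 * ρ ^ 2)⁻¹ * (1 / (((k : ℝ) + 1) * Real.sqrt ((((k : ℝ) + 1) * π * ρ) ^ 2 + 1))) ≤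
        (1 / ((((k : ℝ) + 1) : ℂ) * helixD ρ (k + 1))).re ∧
      (1 / ((((k : ℝ) + 1) : ℂ) * helixD ρ (k + 1))).re ≤
        1 / (((k : ℝ) + 1) * Real.sqrt ((((k : ℝ) + 1) * π * ρ) ^ 2 + 1)) := by
  have hre := re_one_div_mul_sub_I_mul ((k : ℝ) + 1)
    (ρ * Real.arsinh (((k + 1 : ℕ) : ℝ) * π * ρ) / (((k + 1 : ℕ) : ℝ) * π) +
      Real.sqrt ((((k + 1 : ℕ) : ℝ) * π * ρ) ^ 2 + 1)) ρ
  rw [Complex.ofReal_add (k : ℝ) 1, Complex.ofReal_one] at hre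
  rw [helixD, hre]
  push_cast
  have hc : (0 : ℝ) < (k : ℝ) + 1 := by positivity
  set c : ℝ := (k : ℝ) + 1
  set S := Real.sqrt ((c * π * ρ) ^ 2 + 1)
  have hS : 1 ≤ S := Real.one_le_sqrt.2 (by nlinarith [sq_nonneg (c * π * ρ)])
  have ha₀ : 0 ≤ ρ * Real.arsinh (c * π * ρ) / (c * π) := by
    have : 0 ≤ Real.arsinh (c * π * ρ) := Real.arsinh_nonneg_iff.2 (by positivity)
    positivity
  have ha₁ : ρ * Real.arsinh (c * π * ρ) / (c * π) ≤ ρ ^ 2 := by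
    rw [div_le_iff₀ (by positivity)]
    calc _ ≤ ρ * (c * π * ρ) := by gcongr; exact arsinh_le_self (by positivity)
      _ = _ := by ring
  set a := ρ * Real.arsinh (c * π * ρ) / (c * π)
  rw [← one_div_mul_one_div, mul_left_comm]
  constructor
  · gcongr
    rw [← one_div, one_div_mul_one_div, div_le_div_iff₀ (by positivity) (by positivity)]
    have h₁ : a + ρ ^ 2 ≤ 2 * ρ ^ 2 * S := by nlinarith [sq_nonneg ρ]
    have h₂ : ρ ^ 2 ≤ ρ ^ 2 * (a + S) := by nlinarith [sq_nonneg ρ]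
    nlinarith
  · refine mul_le_mul_of_nonneg_left ?_ (by positivity)
    rw [div_le_div_iff₀ (by positivity) (by positivity)]
    nlinarith [sq_nonneg ρ]

lemma helixF_bounds {ρ : ℝ} (hρ : 0 < ρ) :
    (1 + 2 * ρ ^ 2)⁻¹ * helixG ρ ≤ helixF ρ ∧ helixF ρ ≤ helixG ρ := by
  have hG := summable_helixG hρ
  have hF : Summable fun k : ℕ => (1 / ((((k : ℝ) + 1) : ℂ) * helixD ρ (k + 1))).re :=
    hG.of_nonneg_of_le (fun k => le_trans
      (mul_nonneg (by positivity) (helixG_term_pos ρ k).le) (helixF_term_bounds hρ k).1)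
      fun k => (helixF_term_bounds hρ k).2
  refine ⟨?_, hF.tsum_le_tsum (fun k => (helixF_term_bounds hρ k).2) hG⟩
  rw [helixG, ← tsum_mul_left]
  exact (hG.mul_left _).tsum_le_tsum (fun k => (helixF_term_bounds hρ k).1) hF

/-- `F(ρ) ∼ G(ρ)` as `ρ → 0⁺`. -/
theorem helixF_asymptotics :
    Filter.Tendsto (fun ρ : ℝ => helixF ρ / helixG ρ) (nhdsWithin 0 (Set.Ioi 0)) (nhds 1) := by
  have hlim : Tendsto (fun ρ : ℝ => (1 + 2 * ρ ^ 2)⁻¹) (nhdsWithin 0 (Set.Ioi 0)) (nhds 1) := by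
    have h : ContinuousAt (fun ρ : ℝ => (1 + 2 * ρ ^ 2)⁻¹) 0 :=
      ContinuousAt.inv₀ (by fun_prop) (by norm_num)
    simpa using h.tendsto.mono_left nhdsWithin_le_nhds
  refine tendsto_of_tendsto_of_tendsto_of_le_of_le' hlim tendsto_const_nhds ?_ ?_
  · filter_upwards [self_mem_nhdsWithin] with ρ hρ
    exact (le_div_iff₀ (helixG_pos hρ)).2 (helixF_bounds hρ).1
  · filter_upwards [self_mem_nhdsWithin] with ρ hρ
    exact (div_le_one (helixG_pos hρ)).2 (helixF_bounds hρ).2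
end
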